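/- Bilevel reformulation of long-run mean-CVaR optimization: let β ≥ 0 and define f_β(y,i,a) := y + (1-α)⁻¹·max(c(i,a) - y, 0) + β·c(i,a), η^d(f_β(y)) := Σ_{i∈S} π^d(i)·f_β(y,i,d(i)), and η^d(c) := Σ_{i∈S} π^d(i)·c(i,d(i)). Then for every deterministic policy d, CVaR^d + β·η^d(c) = min_{y∈ℝ} η^d(f_β(y)), and the minimum over y is attained at y = VaR^d; consequently, min over deterministic policies d of (CVaR^d + β·η^d(c)) equals min_{y∈ℝ} min_{d} η^d(f_β(y)), with the outer minimum over y attained in the finite set C := {c(i,a) : i∈S, a∈A}. -/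

import Mathlib

/-- The pseudo-CVaR cost `c̃(y,i,a) = y + (1-α)⁻¹ max(c(i,a) - y, 0)`. -/
noncomputable def ctil {S A : Type*} (α : ℝ) (c : S → A → ℝ) (y : ℝ) (i : S) (a : A) : ℝ :=
  y + (1 - α)⁻¹ * max (c i a - y) 0

/-- The pseudo CVaR `ṼC^d(y) = Σ_i π(i) c̃(y,i,d(i))` of a deterministic policy `d`
with stationary distribution `π`. -/
noncomputable def pC {S A : Type*} [Fintype S] (α : ℝ) (c : S → A → ℝ) (π : S → ℝ)
    (d : S → A) (y : ℝ) : ℝ :=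
  ∑ i, π i * ctil α c y i (d i)

/-- The long-run CVaR `CVaR^d = inf_{y ∈ ℝ} ṼC^d(y)`. -/
noncomputable def CV {S A : Type*} [Fintype S] (α : ℝ) (c : S → A → ℝ) (π : S → ℝ)
    (d : S → A) : ℝ :=
  sInf (Set.range (pC α c π d))

/-- The long-run VaR `VaR^d = inf {w : Σ_{i : c(i,d(i)) ≤ w} π(i) ≥ α}`. -/
noncomputable def VaR {S A : Type*} [Fintype S] (α : ℝ) (c : S → A → ℝ) (π : S → ℝ)
    (d : S → A) : ℝ :=
  sInf {w : ℝ | α ≤ ∑ i, if c i (d i) ≤ w then π i else 0}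

/-- The combined mean-CVaR cost `f_β(y,i,a) = c̃(y,i,a) + β c(i,a)`. -/
noncomputable def fbeta {S A : Type*} (α β : ℝ) (c : S → A → ℝ) (y : ℝ) (i : S) (a : A) : ℝ :=
  y + (1 - α)⁻¹ * max (c i a - y) 0 + β * c i a

/-- The long-run average of `f_β(y)` under policy `d`: `η^d(f_β(y))`. -/
noncomputable def etafbeta {S A : Type*} [Fintype S] (α β : ℝ) (c : S → A → ℝ)
    (π : S → ℝ) (d : S → A) (y : ℝ) : ℝ :=
  ∑ i, π i * fbeta α β c y i (d i)

/-- The long-run average cost `η^d(c) = Σ_i π(i) c(i,d(i))`. -/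
noncomputable def etac {S A : Type*} [Fintype S] (c : S → A → ℝ) (π : S → ℝ)
    (d : S → A) : ℝ :=
  ∑ i, π i * c i (d i)

/-- Level `α` is reached by the distribution function of the cost at `VaR`, which is a cost
value, and the mass strictly below `VaR` is at most `α`. -/
theorem VaR_spec {S A : Type*} [Fintype S] (α : ℝ) (hα : α ∈ Set.Ioo (0 : ℝ) 1)
    (c : S → A → ℝ) (π : S → ℝ) (hπ1 : ∑ i, π i = 1) (d : S → A) :
    (∃ i, VaR α c π d = c i (d i)) ∧
      (α ≤ ∑ i, if c i (d i) ≤ VaR α c π d then π i else 0) ∧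
      (∑ i, if c i (d i) < VaR α c π d then π i else 0) ≤ α := by
  classical
  have hS : (Finset.univ : Finset S).Nonempty := by
    by_contra h
    rw [Finset.not_nonempty_iff_eq_empty.mp h] at hπ1
    simp at hπ1
  obtain ⟨m, -, hm⟩ := Finset.exists_max_image Finset.univ (fun i => c i (d i)) hS
  have hmW : α ≤ ∑ i, if c i (d i) ≤ c m (d m) then π i else 0 := by
    have : (∑ i, if c i (d i) ≤ c m (d m) then π i else 0) = 1 := by
      rw [← hπ1]
      exact Finset.sum_congr rfl fun i hi => if_pos (hm i hi)
    rw [this]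
    exact hα.2.le
  obtain ⟨k, hk, hkmin⟩ := Finset.exists_min_image
    (Finset.univ.filter fun j => α ≤ ∑ i, if c i (d i) ≤ c j (d j) then π i else 0)
    (fun i => c i (d i)) ⟨m, by simpa using hmW⟩
  simp only [Finset.mem_filter, Finset.mem_univ, true_and] at hk hkmin
  have hleast : IsLeast {w : ℝ | α ≤ ∑ i, if c i (d i) ≤ w then π i else 0} (c k (d k)) := by
    refine ⟨hk, fun w (hw : α ≤ _) => ?_⟩
    have hne : (Finset.univ.filter fun i => c i (d i) ≤ w).Nonempty := by
      by_contra h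
      rw [Finset.not_nonempty_iff_eq_empty] at h
      rw [← Finset.sum_filter, h, Finset.sum_empty] at hw
      exact absurd hw (not_le.mpr hα.1)
    obtain ⟨j, hj, hjmax⟩ := Finset.exists_max_image _ (fun i => c i (d i)) hne
    simp only [Finset.mem_filter, Finset.mem_univ, true_and] at hj hjmax
    refine (hkmin j (hw.trans_eq (Finset.sum_congr rfl fun i _ => ?_))).trans hj
    exact if_congr ⟨hjmax i, fun h => h.trans hj⟩ rfl rfl
  have hv : VaR α c π d = c k (d k) := hleast.csInf_eq
  rw [hv]
  refine ⟨⟨k, rfl⟩, hk, ?_⟩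
  rcases (Finset.univ.filter fun i => c i (d i) < c k (d k)).eq_empty_or_nonempty with h | h
  · rw [← Finset.sum_filter, h, Finset.sum_empty]
    exact hα.1.le
  · obtain ⟨j, hj, hjmax⟩ := Finset.exists_max_image _ (fun i => c i (d i)) h
    simp only [Finset.mem_filter, Finset.mem_univ, true_and] at hj hjmax
    by_contra! hlt
    refine absurd (hkmin j (hlt.le.trans_eq (Finset.sum_congr rfl fun i _ => ?_))) (not_le.mpr hj)
    exact if_congr ⟨hjmax i, fun h => h.trans_lt hj⟩ rfl rfl

theorem pC_eq {S A : Type*} [Fintype S] (α : ℝ) (c : S → A → ℝ) (π : S → ℝ)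
    (hπ1 : ∑ i, π i = 1) (d : S → A) (y : ℝ) :
    pC α c π d y = y + (1 - α)⁻¹ * ∑ i, π i * max (c i (d i) - y) 0 := by
  simp only [pC, ctil, mul_add, Finset.sum_add_distrib, ← Finset.sum_mul, hπ1, one_mul,
    Finset.mul_sum, mul_left_comm]

/-- The pseudo CVaR is minimized at `VaR`. -/
theorem pC_VaR_le {S A : Type*} [Fintype S] (α : ℝ) (hα : α ∈ Set.Ioo (0 : ℝ) 1)
    (c : S → A → ℝ) (π : S → ℝ) (hπ0 : ∀ i, 0 ≤ π i) (hπ1 : ∑ i, π i = 1) (d : S → A) (y : ℝ) :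
    pC α c π d (VaR α c π d) ≤ pC α c π d y := by
  obtain ⟨-, hle, hlt⟩ := VaR_spec α hα c π hπ1 d
  rw [pC_eq α c π hπ1, pC_eq α c π hπ1]
  generalize VaR α c π d = v at hle hlt
  have h1α : 0 < 1 - α := sub_pos.mpr hα.2
  suffices h : (1 - α) * (v - y) + ∑ i, π i * max (c i (d i) - v) 0 ≤
      ∑ i, π i * max (c i (d i) - y) 0 by
    have := mul_le_mul_of_nonneg_left h (inv_nonneg.mpr h1α.le)
    rw [mul_add, inv_mul_cancel_left₀ h1α.ne'] at this
    linarith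
  rcases le_total v y with hvy | hvy
  · have key : ∑ i, (π i * max (c i (d i) - v) 0 + (v - y) * π i) ≤
        ∑ i, (π i * max (c i (d i) - y) 0 +
          (v - y) * if c i (d i) ≤ v then π i else 0) := by
      refine Finset.sum_le_sum fun i _ => ?_
      have hi := hπ0 i
      split_ifs with h
      · rw [max_eq_right (by linarith), max_eq_right (by linarith)]
      · rw [max_eq_left (by linarith)]
        nlinarith [mul_le_mul_of_nonneg_left (le_max_left (c i (d i) - y) 0) hi]
    simp only [Finset.sum_add_distrib, ← Finset.mul_sum, hπ1] at key
    nlinarith [mul_le_mul_of_nonneg_left hle (sub_nonneg.mpr hvy)]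
  · have key : ∑ i, (π i * max (c i (d i) - v) 0 + (v - y) * π i) ≤
        ∑ i, (π i * max (c i (d i) - y) 0 +
          (v - y) * if c i (d i) < v then π i else 0) := by
      refine Finset.sum_le_sum fun i _ => ?_
      have hi := hπ0 i
      split_ifs with h
      · rw [max_eq_right (by linarith : c i (d i) - v ≤ 0)]
        nlinarith [mul_nonneg hi (le_max_right (c i (d i) - y) 0)]
      · rw [max_eq_left (by linarith), max_eq_left (by linarith)]
        linarith
    simp only [Finset.sum_add_distrib, ← Finset.mul_sum, hπ1] at key
    nlinarith [mul_le_mul_of_nonneg_left hlt (sub_nonneg.mpr hvy)]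

theorem CV_eq_pC_VaR {S A : Type*} [Fintype S] (α : ℝ) (hα : α ∈ Set.Ioo (0 : ℝ) 1)
    (c : S → A → ℝ) (π : S → ℝ) (hπ0 : ∀ i, 0 ≤ π i) (hπ1 : ∑ i, π i = 1) (d : S → A) :
    CV α c π d = pC α c π d (VaR α c π d) :=
  IsLeast.csInf_eq ⟨⟨_, rfl⟩, Set.forall_mem_range.mpr (pC_VaR_le α hα c π hπ0 hπ1 d)⟩

theorem etafbeta_eq {S A : Type*} [Fintype S] (α β : ℝ) (c : S → A → ℝ) (π : S → ℝ)
    (d : S → A) (y : ℝ) :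
    etafbeta α β c π d y = pC α c π d y + β * etac c π d := by
  simp only [etafbeta, fbeta, pC, ctil, etac, Finset.mul_sum, ← Finset.sum_add_distrib]
  exact Finset.sum_congr rfl fun i _ => by ring

/-- Bilevel reformulation of long-run mean-CVaR optimization: for each
deterministic policy, `CVaR^d + β η^d(c) = min_y η^d(f_β(y))`, attained at `y = VaR^d`;
consequently the minimum over deterministic policies equals
`min_{y ∈ ℝ} min_d η^d(f_β(y))`, with the outer minimum attained in the finite set
`C = {c(i,a)}`. -/
theorem mean_cvar_bilevel_reformulation
    {S A : Type*} [Fintype S] [Fintype A] [Nonempty S] [Nonempty A]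
    (p : S → A → S → ℝ) (hp0 : ∀ i a j, 0 ≤ p i a j) (hp1 : ∀ i a, ∑ j, p i a j = 1)
    (c : S → A → ℝ) (α : ℝ) (hα : α ∈ Set.Ioo (0 : ℝ) 1) (β : ℝ) (hβ : 0 ≤ β)
    (sd : (S → A) → S → ℝ)
    (hsd0 : ∀ d i, 0 ≤ sd d i) (hsd1 : ∀ d, ∑ i, sd d i = 1)
    (hsdstat : ∀ (d : S → A) (j : S), ∑ i, sd d i * p i (d i) j = sd d j) :
    (∀ d : S → A,
      CV α c (sd d) d + β * etac c (sd d) d =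
        sInf (Set.range (etafbeta α β c (sd d) d)) ∧
      (∀ y : ℝ, etafbeta α β c (sd d) d (VaR α c (sd d) d) ≤ etafbeta α β c (sd d) d y)) ∧
    (⨅ d : S → A, (CV α c (sd d) d + β * etac c (sd d) d)) =
      sInf (Set.range (fun y : ℝ => ⨅ d : S → A, etafbeta α β c (sd d) d y)) ∧
    (⨅ d : S → A, (CV α c (sd d) d + β * etac c (sd d) d)) =
      ⨅ q : S × A, ⨅ d : S → A, etafbeta α β c (sd d) d (c q.1 q.2) := by
  have hmin : ∀ (d : S → A) (y : ℝ),
      etafbeta α β c (sd d) d (VaR α c (sd d) d) ≤ etafbeta α β c (sd d) d y := fun d y => by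
    rw [etafbeta_eq, etafbeta_eq]
    exact add_le_add_left (pC_VaR_le α hα c _ (hsd0 d) (hsd1 d) d y) _
  have hCV : ∀ d : S → A, CV α c (sd d) d + β * etac c (sd d) d =
      etafbeta α β c (sd d) d (VaR α c (sd d) d) := fun d => by
    rw [etafbeta_eq, CV_eq_pC_VaR α hα c _ (hsd0 d) (hsd1 d)]
  have hbdd : ∀ f : (S → A) → ℝ, BddBelow (Set.range f) := fun f =>
    (Set.finite_range f).bddBelow
  simp only [hCV]
  have hlow : ∀ y : ℝ, (⨅ d : S → A, etafbeta α β c (sd d) d (VaR α c (sd d) d)) ≤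
      ⨅ d : S → A, etafbeta α β c (sd d) d y := fun y =>
    ciInf_mono (hbdd _) fun d => hmin d y
  refine ⟨fun d => ⟨?_, hmin d⟩, le_antisymm ?_ ?_, le_antisymm ?_ ?_⟩
  · exact Eq.symm (IsLeast.csInf_eq ⟨⟨_, rfl⟩, Set.forall_mem_range.mpr (hmin d)⟩)
  · exact le_csInf (Set.range_nonempty _) (Set.forall_mem_range.mpr hlow)
  · refine le_ciInf fun d => ?_
    exact ciInf_le_of_le ⟨_, Set.forall_mem_range.mpr hlow⟩ (VaR α c (sd d) d)
      (ciInf_le (hbdd _) d)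
  · exact le_ciInf fun q => hlow _
  · refine le_ciInf fun d => ?_
    obtain ⟨i, hi⟩ := (VaR_spec α hα c (sd d) (hsd1 d) d).1
    rw [hi]
    exact ciInf_le_of_le (Set.finite_range _).bddBelow (i, d i) (ciInf_le (hbdd _) d)
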